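/- arXiv:2309.03030 — 2 statements merged into one kernel-verified Lean document; each statement's English description precedes it below -/
import Mathlib

section
/- Let F = ⟨b, c⟩ be the free group of rank 2, and for i ∈ ℤ set b_i = c^{-i} b c^{i}. Then for every m ∈ ℤ, both the subgroup ⟨b_m, b_{m+1}, b_{m+2}, …⟩ generated by all b_i with i ≥ m and the subgroup ⟨b_{m-1}, b_{m-2}, b_{m-3}, …⟩ generated by all b_i with i ≤ m−1 are benign subgroups of F. -/
/-- A group is finitely presented if it admits a presentation with finitely many
generators and finitely many defining relations. -/
def FinitelyPresentedGroup (G : Type) [Group G] : Prop :=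
  ∃ (n : ℕ) (S : Finset (FreeGroup (Fin n))),
    Nonempty (G ≃* (FreeGroup (Fin n) ⧸ Subgroup.normalClosure (S : Set (FreeGroup (Fin n)))))

/-- A subgroup `H` of a group `G` is *benign* in `G` if there are a finitely presented
group `K`, an embedding `ι : G →* K` and a finitely generated subgroup `L ≤ K` such
that, identifying `G` and `H` with their images in `K`, one has `G ∩ L = H`. -/
def Benign {G : Type} [Group G] (H : Subgroup G) : Prop :=
  ∃ (K : Type) (_ : Group K) (ι : G →* K) (L : Subgroup K),
    Function.Injective ι ∧ FinitelyPresentedGroup K ∧ L.FG ∧ ι.range ⊓ L = H.map ι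

/-- The generator `b` of the free group `F = ⟨b, c⟩` of rank 2. -/
def bb : FreeGroup (Fin 2) := FreeGroup.of 0

/-- The generator `c` of the free group `F = ⟨b, c⟩` of rank 2. -/
def cc : FreeGroup (Fin 2) := FreeGroup.of 1

/-- The element `b_i = c^{-i} * b * c^i` of `F`, for `i : ℤ`. -/
def bseq (i : ℤ) : FreeGroup (Fin 2) := cc ^ (-i) * bb * cc ^ i

namespace Stmt18

section HNN

variable {M G : Type} [Group M] [Group G]

/-- The isomorphism between the ranges of two embeddings of `M`. -/
noncomputable def rangeEquiv (i j : M →* G) (hi : Function.Injective i)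
    (hj : Function.Injective j) : i.range ≃* j.range :=
  (MonoidHom.ofInjective hi).symm.trans (MonoidHom.ofInjective hj)

theorem rangeEquiv_apply (i j : M →* G) (hi : Function.Injective i)
    (hj : Function.Injective j) (m : M) :
    (rangeEquiv i j hi hj ⟨i m, m, rfl⟩ : G) = j m := by
  have : (⟨i m, m, rfl⟩ : i.range) = MonoidHom.ofInjective hi m := rfl
  rw [this]
  simp only [rangeEquiv, MulEquiv.trans_apply, MulEquiv.symm_apply_apply]
  rfl

theorem hnn_key (i j : M →* G) (hi : Function.Injective i)
    (hj : Function.Injective j) (S : Subgroup G) (hS : ∀ m, i m ∈ S ↔ j m ∈ S) :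
    ∃ (Q : Type) (_ : Group Q) (k : G →* Q) (t : Q), Function.Injective k ∧
      (∀ m, t * k (i m) = k (j m) * t) ∧
      ∀ g, k g ∈ Subgroup.closure (k '' (S : Set G) ∪ {t}) → g ∈ S := by
  classical
  let φ := rangeEquiv i j hi hj
  let M' : Subgroup M := S.comap i
  let i' : M' →* S := (i.comp M'.subtype).codRestrict S (fun m => m.2)
  let j' : M' →* S := (j.comp M'.subtype).codRestrict S (fun m => (hS m).1 m.2)
  have hi' : Function.Injective i' := fun a b h =>
    Subtype.ext (hi (congrArg (Subtype.val) h))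
  have hj' : Function.Injective j' := fun a b h =>
    Subtype.ext (hj (congrArg (Subtype.val) h))
  let φ' := rangeEquiv i' j' hi' hj'
  have hrel : ∀ m, (HNNExtension.t : HNNExtension G _ _ φ) * HNNExtension.of (i m)
      = HNNExtension.of (j m) * HNNExtension.t := by
    intro m
    have := HNNExtension.t_mul_of (φ := φ) ⟨i m, m, rfl⟩
    rwa [rangeEquiv_apply] at this
  let Ψ : HNNExtension S _ _ φ' →* HNNExtension G _ _ φ :=
    HNNExtension.lift (HNNExtension.of.comp S.subtype) HNNExtension.t (by
      rintro ⟨_, m, rfl⟩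
      rw [rangeEquiv_apply]
      exact hrel m)
  have hA : ∀ s : S, (s : G) ∈ i.range → s ∈ i'.range := by
    rintro ⟨_, hs⟩ ⟨m, rfl⟩
    exact ⟨⟨m, hs⟩, rfl⟩
  have hB : ∀ s : S, (s : G) ∈ j.range → s ∈ j'.range := by
    rintro ⟨_, hs⟩ ⟨m, rfl⟩
    exact ⟨⟨m, (hS m).2 hs⟩, rfl⟩
  have hAB : ∀ (u : ℤˣ) (s : S), (s : G) ∈ HNNExtension.toSubgroup i.range j.range u →
      s ∈ HNNExtension.toSubgroup i'.range j'.range u := by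
    intro u s
    rcases Int.units_eq_one_or u with rfl | rfl
    · exact hA s
    · exact hB s
  refine ⟨HNNExtension G _ _ φ, inferInstance, HNNExtension.of, HNNExtension.t,
    HNNExtension.of_injective φ, hrel, ?_⟩
  intro g hg
  have hle : Subgroup.closure ((HNNExtension.of : G →* HNNExtension G _ _ φ) '' (S : Set G)
      ∪ {HNNExtension.t}) ≤ Ψ.range := by
    rw [Subgroup.closure_le]
    rintro _ (⟨s, hs, rfl⟩ | rfl)
    · exact ⟨HNNExtension.of ⟨s, hs⟩, by simp [Ψ]⟩
    · exact ⟨HNNExtension.t, by simp [Ψ]⟩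
  obtain ⟨x, hx⟩ := hle hg
  obtain ⟨d⟩ := HNNExtension.NormalWord.TransversalPair.nonempty S i'.range j'.range
  let w := HNNExtension.NormalWord.equiv φ' d x
  have hw : w.toReducedWord.prod φ' = x := (HNNExtension.NormalWord.equiv φ' d).symm_apply_apply x
  let w' : HNNExtension.NormalWord.ReducedWord G i.range j.range :=
    { head := w.head
      toList := w.toList.map (fun a => (a.1, (a.2 : G)))
      chain := by
        rw [List.isChain_map]
        exact w.chain.imp (fun a b h ha => h (hAB _ _ ha)) }
  have hw' : w'.prod φ = Ψ x := by
    rw [← hw]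
    simp only [HNNExtension.NormalWord.ReducedWord.prod, map_mul, map_list_prod, List.map_map, w']
    have e1 : Ψ (HNNExtension.of w.head) = HNNExtension.of (w.head : G) := by simp [Ψ]
    rw [e1]
    congr 2
    apply List.map_congr_left
    intro a _
    simp [Ψ]
  have hnil := HNNExtension.ReducedWord.toList_eq_nil_of_mem_of_range φ w'
    (by rw [hw', hx]; exact ⟨g, rfl⟩)
  have : HNNExtension.of (φ := φ) g = HNNExtension.of (w.head : G) := by
    rw [← hx, ← hw', HNNExtension.NormalWord.ReducedWord.prod, hnil]
    simp [w']
  rw [HNNExtension.of_injective φ this]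
  exact w.head.2

end HNN

abbrev F := FreeGroup (Fin 2)

/-- The shift action. -/
def sh : Multiplicative ℤ →* MulAut (FreeGroup ℤ) where
  toFun n := FreeGroup.freeGroupCongr (Equiv.subRight n.toAdd)
  map_one' := by
    apply MulEquiv.toMonoidHom_injective
    ext i; simp
  map_mul' a b := by
    apply MulEquiv.toMonoidHom_injective
    ext i
    simp [sub_sub, add_comm]

@[simp] theorem sh_of (n : Multiplicative ℤ) (i : ℤ) :
    sh n (FreeGroup.of i) = FreeGroup.of (i - n.toAdd) := by
  simp [sh]

abbrev E := FreeGroup ℤ ⋊[sh] Multiplicative ℤ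

def toE : F →* E := FreeGroup.lift
  ![SemidirectProduct.inl (FreeGroup.of 0), SemidirectProduct.inr (Multiplicative.ofAdd 1)]

def gN : FreeGroup ℤ →* F := FreeGroup.lift bseq

@[simp] theorem toE_bb : toE bb = SemidirectProduct.inl (FreeGroup.of 0) := by simp [toE, bb]
@[simp] theorem toE_cc : toE cc = SemidirectProduct.inr (Multiplicative.ofAdd 1) := by
  simp [toE, cc]

theorem F_hom_ext {P : Type} [Group P] {f g : F →* P} (h0 : f bb = g bb) (h1 : f cc = g cc) :
    f = g := by
  ext i
  fin_cases i
  · exact h0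
  · exact h1

theorem toE_bseq (i : ℤ) : toE (bseq i) = SemidirectProduct.inl (FreeGroup.of i) := by
  have h : SemidirectProduct.inl (FreeGroup.of i) =
    (SemidirectProduct.inl (sh (Multiplicative.ofAdd (-i)) (FreeGroup.of 0)) : E) := by
    rw [sh_of]; simp
  rw [h, SemidirectProduct.inl_aut]
  simp only [bseq, map_mul, map_zpow, toE_bb, toE_cc]
  have hz : ∀ k : ℤ, (SemidirectProduct.inr (Multiplicative.ofAdd (1 : ℤ)) : E) ^ k =
      SemidirectProduct.inr (Multiplicative.ofAdd k) := by
    intro k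
    rw [← map_zpow SemidirectProduct.inr, ← ofAdd_zsmul]
    simp
  rw [hz, hz, ← ofAdd_neg, neg_neg]

theorem bseq_conj (n i : ℤ) : cc ^ n * bseq i * cc ^ (-n) = bseq (i - n) := by
  simp only [bseq]; group

def fromE : E →* F := SemidirectProduct.lift gN (zpowersHom F cc) (by
  intro n
  ext i
  simp only [gN, MonoidHom.comp_apply, MulEquiv.toMonoidHom_eq_coe, MonoidHom.coe_coe, sh_of,
    FreeGroup.lift_apply_of, zpowersHom_apply, MulAut.conj_apply, ← bseq_conj, zpow_neg])

theorem fromE_toE (x : F) : fromE (toE x) = x := by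
  have : fromE.comp toE = MonoidHom.id F := by
    apply F_hom_ext
    · simp [fromE, gN, bseq]
    · simp [fromE]
  exact DFunLike.congr_fun this x

def H0 : Subgroup F := Subgroup.closure {x | ∃ i : ℤ, 0 ≤ i ∧ x = bseq i}
def HN : Subgroup (FreeGroup ℤ) := Subgroup.closure {x | ∃ i : ℤ, 0 ≤ i ∧ x = FreeGroup.of i}

theorem mem_H0 (x : F) : x ∈ H0 ↔ (toE x).right = 1 ∧ (toE x).left ∈ HN := by
  constructor
  · intro h
    have : H0 ≤ (HN.map SemidirectProduct.inl).comap toE := by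
      rw [H0, Subgroup.closure_le]
      rintro _ ⟨i, hi, rfl⟩
      exact ⟨FreeGroup.of i, Subgroup.subset_closure ⟨i, hi, rfl⟩, (toE_bseq i).symm⟩
    obtain ⟨y, hy, h⟩ := this h
    rw [← h]
    exact ⟨rfl, hy⟩
  · rintro ⟨h1, h2⟩
    have hx : gN (toE x).left = x := by
      conv_rhs => rw [← fromE_toE x, ← SemidirectProduct.inl_left_mul_inr_right (toE x), h1]
      simp [fromE]
    rw [← hx]
    have : HN ≤ H0.comap gN := by
      rw [HN, Subgroup.closure_le]
      rintro _ ⟨i, hi, rfl⟩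
      exact Subgroup.subset_closure ⟨i, hi, by simp [gN]⟩
    exact this h2

def th (e : ℤ) : F →* F := FreeGroup.lift ![bseq e, cc ^ 2]

@[simp] theorem th_bb (e : ℤ) : th e bb = bseq e := by simp [th, bb]
@[simp] theorem th_cc (e : ℤ) : th e cc = cc ^ 2 := by simp [th, cc]

def D (e : ℤ) : FreeGroup ℤ →* FreeGroup ℤ := FreeGroup.lift fun i => FreeGroup.of (2 * i + e)

def Dinv (e : ℤ) : FreeGroup ℤ →* FreeGroup ℤ :=
  FreeGroup.lift fun i => if i % 2 = e then FreeGroup.of (i / 2) else 1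

theorem Dinv_D (e : ℤ) (h0 : 0 ≤ e) (h2 : e < 2) (x) : Dinv e (D e x) = x := by
  have : (Dinv e).comp (D e) = MonoidHom.id _ := by
    ext i
    have h1 : (2 * i + e) % 2 = e := by omega
    have h3 : (2 * i + e) / 2 = i := by omega
    simp [D, Dinv, h1, h3]
  exact DFunLike.congr_fun this x

theorem th_bseq (e i : ℤ) : th e (bseq i) = bseq (2 * i + e) := by
  simp only [bseq, map_mul, map_zpow, th_bb, th_cc]
  group

def EE (e : ℤ) : E →* E := SemidirectProduct.map (D e) (powMonoidHom 2) (by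
  intro n
  ext i
  have h2 : (powMonoidHom 2 n).toAdd = 2 * n.toAdd := by simp
  simp only [D, MonoidHom.comp_apply, MulEquiv.toMonoidHom_eq_coe, MonoidHom.coe_coe, sh_of,
    FreeGroup.lift_apply_of, h2]
  congr 1
  ring)

theorem toE_th (e : ℤ) (x : F) : toE (th e x) = EE e (toE x) := by
  have : toE.comp (th e) = (EE e).comp toE := by
    apply F_hom_ext
    · simp [toE_bseq, EE, D]
    · simp [EE]
  exact DFunLike.congr_fun this x

theorem sq_inj : Function.Injective (powMonoidHom 2 : Multiplicative ℤ →* Multiplicative ℤ) := by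
  intro a b h
  have : 2 * a.toAdd = 2 * b.toAdd := by
    have := congrArg Multiplicative.toAdd h
    simpa using this
  apply Multiplicative.toAdd.injective
  omega

theorem th_inj (e : ℤ) (h0 : 0 ≤ e) (h2 : e < 2) : Function.Injective (th e) := by
  intro x y h
  have h' := congrArg toE h
  rw [toE_th, toE_th] at h'
  have hl : D e (toE x).left = D e (toE y).left := congrArg SemidirectProduct.left h'
  have hr := sq_inj (congrArg SemidirectProduct.right h')
  have hl' := congrArg (Dinv e) hl
  rw [Dinv_D e h0 h2, Dinv_D e h0 h2] at hl'
  rw [← fromE_toE x, ← fromE_toE y]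
  congr 1
  exact SemidirectProduct.ext hl' hr

theorem th_mem (e : ℤ) (h0 : 0 ≤ e) (h2 : e < 2) (x : F) : x ∈ H0 ↔ th e x ∈ H0 := by
  constructor
  · intro h
    have : H0 ≤ H0.comap (th e) := by
      conv_lhs => rw [H0]
      rw [Subgroup.closure_le]
      rintro _ ⟨i, hi, rfl⟩
      exact Subgroup.subset_closure ⟨2 * i + e, by omega, th_bseq e i⟩
    exact this h
  · rw [mem_H0, mem_H0, toE_th]
    rintro ⟨h1, h3⟩
    refine ⟨sq_inj (by rw [map_one]; exact h1), ?_⟩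
    have : HN ≤ HN.comap (Dinv e) := by
      conv_lhs => rw [HN]
      rw [Subgroup.closure_le]
      rintro _ ⟨i, hi, rfl⟩
      simp only [Dinv, Subgroup.coe_comap, Set.mem_preimage, FreeGroup.lift_apply_of, SetLike.mem_coe]
      split_ifs
      · exact Subgroup.subset_closure ⟨i / 2, by omega, rfl⟩
      · exact one_mem _
    have h4 := this h3
    rw [← Dinv_D e h0 h2 (toE x).left]
    exact h4

def xg (i : Fin 4) : FreeGroup (Fin 4) := FreeGroup.of i

open Classical in
noncomputable def rels : Finset (FreeGroup (Fin 4)) :=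
  {xg 2 * xg 0 * (xg 0 * xg 2)⁻¹, xg 2 * xg 1 * (xg 1 ^ 2 * xg 2)⁻¹,
   xg 3 * xg 0 * ((xg 1)⁻¹ * xg 0 * xg 1 * xg 3)⁻¹, xg 3 * xg 1 * (xg 1 ^ 2 * xg 3)⁻¹}

abbrev K := FreeGroup (Fin 4) ⧸ Subgroup.normalClosure (rels : Set (FreeGroup (Fin 4)))

noncomputable def kg (i : Fin 4) : K := QuotientGroup.mk (xg i)

theorem rel_eq {x y : FreeGroup (Fin 4)} (h : x * y⁻¹ ∈ rels) :
    (QuotientGroup.mk x : K) = QuotientGroup.mk y := by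
  rw [← mul_inv_eq_one]
  exact (QuotientGroup.eq_one_iff _).2 (Subgroup.subset_normalClosure h)

noncomputable def iota : F →* K := FreeGroup.lift ![kg 0, kg 1]

@[simp] theorem iota_bb : iota bb = kg 0 := by simp [iota, bb]
@[simp] theorem iota_cc : iota cc = kg 1 := by simp [iota, cc]

theorem r1 : kg 2 * kg 0 = kg 0 * kg 2 := rel_eq (x := xg 2 * xg 0) (by simp [rels])
theorem r2 : kg 2 * kg 1 = kg 1 ^ 2 * kg 2 := rel_eq (x := xg 2 * xg 1) (by simp [rels])
theorem r3 : kg 3 * kg 0 = (kg 1)⁻¹ * kg 0 * kg 1 * kg 3 :=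
  rel_eq (x := xg 3 * xg 0) (by simp [rels])
theorem r4 : kg 3 * kg 1 = kg 1 ^ 2 * kg 3 := rel_eq (x := xg 3 * xg 1) (by simp [rels])

theorem iota_th0 (x : F) : iota (th 0 x) = kg 2 * iota x * (kg 2)⁻¹ := by
  have : iota.comp (th 0) = (MulAut.conj (kg 2)).toMonoidHom.comp iota := by
    apply F_hom_ext
    · simp [bseq, r1]
    · simp [r2]
  exact DFunLike.congr_fun this x

theorem iota_th1 (x : F) : iota (th 1 x) = kg 3 * iota x * (kg 3)⁻¹ := by
  have : iota.comp (th 1) = (MulAut.conj (kg 3)).toMonoidHom.comp iota := by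
    apply F_hom_ext
    · simp [bseq, r3]
    · simp [r4]
  exact DFunLike.congr_fun this x

noncomputable def LL : Subgroup K := Subgroup.closure {kg 0, kg 2, kg 3}

theorem kg_mem {i : Fin 4} (h : i ≠ 1) : kg i ∈ LL := by
  apply Subgroup.subset_closure
  fin_cases i <;> simp_all

theorem iota_bseq_mem (n : ℕ) : iota (bseq n) ∈ LL := by
  induction n using Nat.strong_induction_on with
  | _ n ih =>
    rcases Nat.even_or_odd' n with ⟨k, rfl | rfl⟩
    · rcases Nat.eq_zero_or_pos k with rfl | hk
      · simpa [bseq] using kg_mem (i := 0) (by decide)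
      · have h := th_bseq 0 k
        have h2 : ((2 * k : ℕ) : ℤ) = 2 * k + 0 := by push_cast; ring
        rw [h2, ← h, iota_th0]
        exact mul_mem (mul_mem (kg_mem (by decide)) (ih k (by omega)))
          (inv_mem (kg_mem (by decide)))
    · have h := th_bseq 1 k
      have h2 : ((2 * k + 1 : ℕ) : ℤ) = 2 * k + 1 := by push_cast; ring
      rw [h2, ← h, iota_th1]
      exact mul_mem (mul_mem (kg_mem (by decide)) (ih k (by omega)))
        (inv_mem (kg_mem (by decide)))

theorem main_aux : Function.Injective iota ∧ ∀ x, iota x ∈ LL → x ∈ H0 := by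
  obtain ⟨Q1, _, k1, t, hk1, ht, hm1⟩ := hnn_key (MonoidHom.id F) (th 0)
    Function.injective_id (th_inj 0 le_rfl (by norm_num)) H0
    (th_mem 0 le_rfl (by norm_num))
  set S1 := Subgroup.closure (k1 '' (H0 : Set F) ∪ {t}) with hS1
  have hmem : ∀ x, k1 x ∈ S1 ↔ x ∈ H0 := fun x =>
    ⟨hm1 x, fun h => Subgroup.subset_closure (Or.inl ⟨x, h, rfl⟩)⟩
  obtain ⟨Q2, _, k2, s, hk2, hs, hm2⟩ := hnn_key k1 (k1.comp (th 1)) hk1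
    (hk1.comp (th_inj 1 (by norm_num) (by norm_num))) S1
    (fun m => by
      rw [MonoidHom.comp_apply, hmem, hmem]
      exact th_mem 1 (by norm_num) (by norm_num) m)
  let f : FreeGroup (Fin 4) →* Q2 := FreeGroup.lift ![k2 (k1 bb), k2 (k1 cc), k2 t, s]
  have f0 : f (xg 0) = k2 (k1 bb) := by simp [f, xg]
  have f1 : f (xg 1) = k2 (k1 cc) := by simp [f, xg]
  have f2 : f (xg 2) = k2 t := by simp [f, xg]
  have f3 : f (xg 3) = s := by simp [f, xg]
  have hf : Subgroup.normalClosure (rels : Set (FreeGroup (Fin 4))) ≤ f.ker := by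
    apply Subgroup.normalClosure_le_normal
    intro r hr
    have a1 := ht bb
    have a2 := ht cc
    have a3 := hs bb
    have a4 := hs cc
    simp only [MonoidHom.id_apply, MonoidHom.comp_apply, th_bb, th_cc, bseq, neg_zero, zpow_zero,
      one_mul, mul_one, zpow_one, zpow_neg, map_mul, map_pow, map_inv] at a1 a2 a3 a4
    simp only [rels, Finset.coe_insert, Finset.coe_singleton, Set.mem_insert_iff,
      Set.mem_singleton_iff] at hr
    rcases hr with rfl | rfl | rfl | rfl <;>
      simp only [SetLike.mem_coe, MonoidHom.mem_ker, map_mul, map_inv, map_pow, f0, f1, f2, f3]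
        <;> rw [mul_inv_eq_one.2]
    · rw [← map_mul, a1, map_mul]
    · rw [← map_mul, a2, map_mul, map_pow]
    · exact a3
    · exact a4
  let p : K →* Q2 := QuotientGroup.lift _ f hf
  have pk : ∀ i, p (kg i) = f (xg i) := fun i => rfl
  have hp : ∀ x, p (iota x) = k2 (k1 x) := by
    intro x
    have : p.comp iota = k2.comp k1 := by
      apply F_hom_ext
      · simp [pk, f0]
      · simp [pk, f1]
    exact DFunLike.congr_fun this x
  refine ⟨?_, ?_⟩
  · intro x y h
    apply hk1; apply hk2
    rw [← hp, ← hp, h]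
  · intro x hx
    apply hm1; apply hm2
    rw [← hp]
    have : LL ≤ (Subgroup.closure (k2 '' (S1 : Set Q1) ∪ {s})).comap p := by
      rw [LL, Subgroup.closure_le]
      rintro _ (rfl | rfl | rfl)
      · refine Subgroup.subset_closure (Or.inl ⟨k1 bb, (hmem _).2 ?_, ?_⟩)
        · exact Subgroup.subset_closure ⟨0, le_rfl, by simp [bseq]⟩
        · rw [pk, f0]
      · exact Subgroup.subset_closure (Or.inl ⟨t, Subgroup.subset_closure (Or.inr rfl), by
          rw [pk, f2]⟩)
      · exact Subgroup.subset_closure (Or.inr (by rw [pk, f3]; rfl))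
    exact this hx

theorem benign_H0 : Benign H0 := by
  refine ⟨K, inferInstance, iota, LL, main_aux.1, ⟨4, rels, ⟨MulEquiv.refl _⟩⟩, ?_, ?_⟩
  · rw [Subgroup.fg_iff]
    exact ⟨_, rfl, by simp⟩
  · apply le_antisymm
    · rintro _ ⟨⟨x, rfl⟩, hx⟩
      exact ⟨x, main_aux.2 x hx, rfl⟩
    · refine le_inf (Subgroup.map_le_range _ _) ?_
      rw [Subgroup.map_le_iff_le_comap, H0, Subgroup.closure_le]
      rintro _ ⟨i, hi, rfl⟩
      lift i to ℕ using hi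
      exact iota_bseq_mem i

theorem benign_map {H : Subgroup F} (h : Benign H) (a a' : F →* F) (h1 : ∀ x, a (a' x) = x)
    (h2 : ∀ x, a' (a x) = x) : Benign (H.map a) := by
  obtain ⟨K, _, i, L, hi, hK, hL, hH⟩ := h
  refine ⟨K, inferInstance, i.comp a', L, hi.comp (Function.LeftInverse.injective h1), hK, hL, ?_⟩
  have h3 : a'.range = ⊤ := MonoidHom.range_eq_top.2 (fun x => ⟨a x, h2 x⟩)
  have h4 : a'.comp a = MonoidHom.id F := MonoidHom.ext h2
  rw [MonoidHom.range_comp, h3, ← MonoidHom.range_eq_map, hH, Subgroup.map_map,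
    MonoidHom.comp_assoc, h4, MonoidHom.comp_id]

theorem map_H0 (a : F →* F) (q : ℤ → ℤ) (ha : ∀ i, a (bseq i) = bseq (q i)) :
    H0.map a = Subgroup.closure {x | ∃ i : ℤ, 0 ≤ i ∧ x = bseq (q i)} := by
  rw [H0, MonoidHom.map_closure]
  congr 1
  ext x
  constructor
  · rintro ⟨_, ⟨i, hi, rfl⟩, rfl⟩
    exact ⟨i, hi, ha i⟩
  · rintro ⟨i, hi, rfl⟩
    exact ⟨_, ⟨i, hi, rfl⟩, ha i⟩

def cj (m : ℤ) : F →* F := (MulAut.conj (cc ^ (-m))).toMonoidHom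

theorem cj_apply (m : ℤ) (x : F) : cj m x = cc ^ (-m) * x * cc ^ m := by
  have : cj m x = cc ^ (-m) * x * (cc ^ (-m))⁻¹ := rfl
  rw [this, zpow_neg, inv_inv]

theorem cj_cj (m : ℤ) (x : F) : cj m (cj (-m) x) = x := by
  simp only [cj_apply]; group

theorem cj_bseq (m i : ℤ) : cj m (bseq i) = bseq (i + m) := by
  simp only [cj_apply, bseq]; group

def fl : F →* F := FreeGroup.lift ![bb, cc⁻¹]

@[simp] theorem fl_bb : fl bb = bb := by simp [fl, bb]
@[simp] theorem fl_cc : fl cc = cc⁻¹ := by simp [fl, cc]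

theorem fl_fl (x : F) : fl (fl x) = x := by
  have : fl.comp fl = MonoidHom.id F := by
    apply F_hom_ext <;> simp
  exact DFunLike.congr_fun this x

theorem fl_bseq (i : ℤ) : fl (bseq i) = bseq (-i) := by
  simp [bseq]

end Stmt18

theorem stmt18 (m : ℤ) :
    -- `⟨b_m, b_{m+1}, b_{m+2}, …⟩` is benign in `F = ⟨b, c⟩`:
    Benign (Subgroup.closure {x | ∃ i : ℤ, m ≤ i ∧ x = bseq i}) ∧
    -- `⟨b_{m-1}, b_{m-2}, b_{m-3}, …⟩` is benign in `F = ⟨b, c⟩`: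
    Benign (Subgroup.closure {x | ∃ i : ℤ, i ≤ m - 1 ∧ x = bseq i}) := by
  constructor
  · have h := Stmt18.benign_map Stmt18.benign_H0 (Stmt18.cj m) (Stmt18.cj (-m))
      (Stmt18.cj_cj m) (fun x => by simpa using Stmt18.cj_cj (-m) x)
    rw [Stmt18.map_H0 _ (fun i => i + m) (Stmt18.cj_bseq m)] at h
    convert h using 3
    ext x
    constructor
    · rintro ⟨i, hi, rfl⟩
      exact ⟨i - m, by omega, by simp⟩
    · rintro ⟨i, hi, rfl⟩
      exact ⟨i + m, by omega, rfl⟩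
  · have h := Stmt18.benign_map Stmt18.benign_H0 ((Stmt18.cj (m - 1)).comp Stmt18.fl)
      (Stmt18.fl.comp (Stmt18.cj (-(m - 1))))
      (fun x => by
        simp only [MonoidHom.comp_apply, Stmt18.fl_fl]
        exact Stmt18.cj_cj (m - 1) x)
      (fun x => by
        simp only [MonoidHom.comp_apply]
        have := Stmt18.cj_cj (-(m - 1)) (Stmt18.fl x)
        rw [neg_neg] at this
        rw [this, Stmt18.fl_fl])
    rw [Stmt18.map_H0 _ (fun i => -i + (m - 1)) (fun i => by
      rw [MonoidHom.comp_apply, Stmt18.fl_bseq, Stmt18.cj_bseq])] at h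
    convert h using 3
    ext x
    constructor
    · rintro ⟨i, hi, rfl⟩
      exact ⟨m - 1 - i, by omega, by congr 1; ring⟩
    · rintro ⟨i, hi, rfl⟩
      exact ⟨-i + (m - 1), by omega, rfl⟩
end

section
/- Let F = ⟨b, c⟩ be the free group of rank 2, and for i ∈ ℤ set b_i = c^{-i} b c^{i}. Then for every non-negative integer m, the subgroup J = ⟨…, b_{-2}, b_{-1}, b_m, b_{m+1}, …⟩ of F generated by all b_i with i < 0 together with all b_i with i ≥ m is a benign subgroup of F, and it is also a benign subgroup of the free group ⟨a, b, c⟩ of rank 3 (containing F as the free factor generated by b and c). -/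
/-- The generator `b` of the free group `⟨a, b, c⟩` of rank 3 (with `a` the generator
with index `0`). -/
def bb3 : FreeGroup (Fin 3) := FreeGroup.of 1

/-- The generator `c` of the free group `⟨a, b, c⟩` of rank 3. -/
def cc3 : FreeGroup (Fin 3) := FreeGroup.of 2

/-- The element `b_i = c^{-i} * b * c^i` of `⟨a, b, c⟩`, for `i : ℤ`. -/
def bseq3 (i : ℤ) : FreeGroup (Fin 3) := cc3 ^ (-i) * bb3 * cc3 ^ i


open HNNExtension HNNExtension.NormalWord in
theorem exists_good_transversal {G : Type} [Group G] (A H : Subgroup G) :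
    ∃ (T : Set G) (hT : Subgroup.IsComplement (A : Set G) T), ∀ h ∈ H, ((hT.equiv h).2 : G) ∈ H := by
  classical
  let f : Quotient (QuotientGroup.rightRel A) → G := fun q =>
    if h : ∃ g ∈ H, Quotient.mk'' g = q then h.choose else q.out
  have hf : ∀ q, Quotient.mk'' (f q) = q := by
    intro q
    by_cases h : ∃ g ∈ H, Quotient.mk'' g = q
    · simp only [f, dif_pos h]
      exact h.choose_spec.2
    · simp only [f, dif_neg h]
      exact Quotient.out_eq' q
  have hT := Subgroup.isComplement_range_right hf
  refine ⟨Set.range f, hT, fun h hh => ?_⟩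
  obtain ⟨q, hq⟩ := (hT.equiv h).2.2
  rw [← hq]
  have hc : Quotient.mk'' h = q := by
    have h1 := hT.equiv_fst_mul_equiv_snd h
    rw [← hf q, hq]
    apply Quotient.sound'
    rw [QuotientGroup.rightRel_apply]
    have h2 : ((hT.equiv h).2 : G) * h⁻¹ = ((hT.equiv h).1 : G)⁻¹ := by
      rw [mul_inv_eq_iff_eq_mul, eq_inv_mul_iff_mul_eq]
      exact h1
    rw [h2]
    exact inv_mem (hT.equiv h).1.2
  have he : ∃ g ∈ H, Quotient.mk'' g = q := ⟨h, hh, hc⟩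
  simp only [f, dif_pos he]
  exact he.choose_spec.1

open HNNExtension HNNExtension.NormalWord in
theorem hnn_inter {G : Type} [Group G] {A B : Subgroup G} (φ : A ≃* B) (H : Subgroup G)
    (hφ : ∀ a : A, (a : G) ∈ H ↔ (φ a : G) ∈ H) (g : G)
    (hg : (of g : HNNExtension G A B φ) ∈ H.map of ⊔ Subgroup.zpowers t) : g ∈ H := by
  choose T hT hTH using fun u => exists_good_transversal (toSubgroup A B u) H
  let d : TransversalPair G A B := ⟨T, hT⟩
  have hφ' : ∀ (u : ℤˣ) (x : toSubgroup A B u), (x : G) ∈ H → (toSubgroupEquiv φ u x : G) ∈ H := by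
    intro u x hx
    rcases Int.units_eq_one_or u with rfl | rfl
    · exact (hφ x).1 hx
    · refine (hφ (φ.symm x)).2 ?_
      have := φ.apply_symm_apply x
      exact (congrArg (fun y : B => (y : G) ∈ H) this).mpr hx
  let W : Set (NormalWord d) := {w | w.head ∈ H ∧ ∀ p ∈ w.toList, p.2 ∈ H}
  have hu : ∀ (u : ℤˣ) (w : NormalWord d), w ∈ W → unitsSMul φ u w ∈ W := by
    intro u w hw
    by_cases h : Cancels u w
    · simp only [unitsSMul, dif_pos h]
      cases w using consRecOn with
      | ofGroup => simp [Cancels] at h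
      | cons g u' w h1 h2 ih =>
        simp only [unitsSMulWithCancel, consRecOn_cons]
        have hw1 : g ∈ H := hw.1
        have hw2 := hw.2
        simp only [cons_toList, List.mem_cons, forall_eq_or_imp] at hw2
        exact ⟨mul_mem (hφ' u ⟨g, h.1⟩ hw1) hw2.1, hw2.2⟩
    · simp only [unitsSMul, dif_neg h]
      have h2 : (((d.compl u).equiv w.head).2 : G) ∈ H := hTH u _ hw.1
      have h1 : (((d.compl u).equiv w.head).1 : G) ∈ H := by
        have := (d.compl u).equiv_fst_mul_equiv_snd w.head
        rw [← mul_mem_cancel_right h2, this]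
        exact hw.1
      refine ⟨hφ' u _ h1, ?_⟩
      intro p hp
      simp only [cons_toList, group_smul_toList, group_smul_head, List.mem_cons] at hp
      rcases hp with rfl | hp
      · simpa [unitsSMulGroup_snd] using h2
      · exact hw.2 p hp
  let St : Subgroup (HNNExtension G A B φ) :=
    { carrier := {x | (∀ w ∈ W, x • w ∈ W) ∧ ∀ w ∈ W, x⁻¹ • w ∈ W}
      mul_mem' := by
        rintro x y ⟨hx, hx'⟩ ⟨hy, hy'⟩
        refine ⟨fun w hw => ?_, fun w hw => ?_⟩
        · rw [mul_smul]; exact hx _ (hy _ hw)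
        · rw [mul_inv_rev, mul_smul]; exact hy' _ (hx' _ hw)
      one_mem' := by simp
      inv_mem' := by
        rintro x ⟨hx, hx'⟩
        exact ⟨hx', by simpa using hx⟩ }
  have hle : H.map of ⊔ Subgroup.zpowers (t : HNNExtension G A B φ) ≤ St := by
    have hof : ∀ h ∈ H, ∀ w ∈ W, (of h : HNNExtension G A B φ) • w ∈ W := by
      intro h hh w hw
      rw [of_smul_eq_smul]
      exact ⟨mul_mem hh hw.1, hw.2⟩
    refine sup_le ?_ ?_
    · rintro _ ⟨h, hh, rfl⟩
      refine ⟨hof h hh, ?_⟩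
      rw [← map_inv]
      exact hof _ (inv_mem hh)
    · rw [Subgroup.zpowers_le]
      refine ⟨fun w hw => ?_, fun w hw => ?_⟩
      · rw [t_smul_eq_unitsSMul]; exact hu _ _ hw
      · have := t_pow_smul_eq_unitsSMul φ (-1) w
        simp only [Units.val_neg, Units.val_one, zpow_neg, zpow_one] at this
        rw [this]; exact hu _ _ hw
  have he : (empty : NormalWord d) ∈ W := ⟨one_mem _, by simp⟩
  have := (hle hg).1 _ he
  rw [of_smul_eq_smul] at this
  simpa using this.1

theorem hnn_exists {G E : Type} [Group G] [Group E] (α β : E →* G) (hα : Function.Injective α)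
    (hβ : Function.Injective β) (H : Subgroup G) (h : ∀ e, α e ∈ H ↔ β e ∈ H) :
    ∃ (G' : Type) (_ : Group G') (ι : G →* G') (t : G'), Function.Injective ι ∧
      (∀ e, t * ι (α e) * t⁻¹ = ι (β e)) ∧
      ∀ g, ι g ∈ H.map ι ⊔ Subgroup.zpowers t → g ∈ H := by
  let φ : α.range ≃* β.range :=
    (MonoidHom.ofInjective hα).symm.trans (MonoidHom.ofInjective hβ)
  have hφ : ∀ e, φ (MonoidHom.ofInjective hα e) = MonoidHom.ofInjective hβ e := by
    intro e; simp [φ]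
  refine ⟨HNNExtension G α.range β.range φ, inferInstance, HNNExtension.of, HNNExtension.t,
    HNNExtension.of_injective φ, fun e => ?_, fun g hg => hnn_inter φ H ?_ g hg⟩
  · have := HNNExtension.equiv_eq_conj (φ := φ) (MonoidHom.ofInjective hα e)
    rw [hφ] at this
    exact this.symm
  · intro a
    obtain ⟨e, rfl⟩ := (MonoidHom.ofInjective hα).surjective a
    rw [hφ]
    exact h e

theorem map_mem_closure_iff {X Y : Type} (f : X → Y) (hf : Function.Injective f) (S : Set Y)
    (w : FreeGroup X) : FreeGroup.map f w ∈ Subgroup.closure (FreeGroup.of '' S) ↔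
      w ∈ Subgroup.closure (FreeGroup.of '' (f ⁻¹' S)) := by
  classical
  have hr : ∀ {Z : Type} (T : Set Z), ∃ ρ : FreeGroup Z →* FreeGroup Z,
      ∀ z, ρ (FreeGroup.of z) = if z ∈ T then FreeGroup.of z else 1 := fun T =>
    ⟨FreeGroup.lift fun z => if z ∈ T then FreeGroup.of z else 1, fun z => by simp⟩
  constructor
  · intro h
    obtain ⟨ρ, hρ⟩ := hr S
    obtain ⟨ρ', hρ'⟩ := hr (f ⁻¹' S)
    have h1 : Subgroup.closure (FreeGroup.of '' S) ≤ ρ.eqLocus (MonoidHom.id _) := by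
      rw [Subgroup.closure_le]
      rintro _ ⟨s, hs, rfl⟩
      change ρ (FreeGroup.of s) = FreeGroup.of s
      simp [hρ, hs]
    have h2 : ρ.comp (FreeGroup.map f) = (FreeGroup.map f).comp ρ' := by
      ext x
      by_cases hx : f x ∈ S <;> simp [hρ, hρ', hx]
    have h3 : ρ' w = w := by
      have h4 : ρ (FreeGroup.map f w) = FreeGroup.map f w := h1 h
      have h5 := DFunLike.congr_fun h2 w
      simp only [MonoidHom.comp_apply, h4] at h5
      exact (FreeGroup.map_injective hf h5).symm
    rw [← h3]
    have h6 : ρ'.range ≤ Subgroup.closure (FreeGroup.of '' (f ⁻¹' S)) := by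
      rintro _ ⟨x, rfl⟩
      induction x using FreeGroup.induction_on with
      | C1 => simp
      | of x =>
        rw [hρ']
        split_ifs with hx
        · exact Subgroup.subset_closure ⟨x, hx, rfl⟩
        · exact one_mem _
      | inv_of x hx => rw [map_inv]; exact inv_mem hx
      | mul x y hx hy => rw [map_mul]; exact mul_mem hx hy
    exact h6 ⟨w, rfl⟩
  · intro h
    have : Subgroup.closure (FreeGroup.of '' (f ⁻¹' S)) ≤
        (Subgroup.closure (FreeGroup.of '' S)).comap (FreeGroup.map f) := by
      rw [Subgroup.closure_le]
      rintro _ ⟨s, hs, rfl⟩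
      simp only [Subgroup.coe_comap, Set.mem_preimage, FreeGroup.map.of]
      exact Subgroup.subset_closure ⟨f s, hs, rfl⟩
    exact this h

/-- Shift action by steps of `M` on the free group with basis `B × ℤ`. -/
def shAct (B : Type) (M : ℤ) : Multiplicative ℤ →* MulAut (FreeGroup (B × ℤ)) where
  toFun n := FreeGroup.freeGroupCongr ((Equiv.refl B).prodCongr (Equiv.addRight (M * n.toAdd)))
  map_one' := by
    ext x
    induction x using FreeGroup.induction_on with
    | C1 => simp
    | of x => simp
    | inv_of x hx => simp
    | mul x y hx hy => rw [map_mul, hx, hy, map_mul]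
  map_mul' m n := by
    ext x
    induction x using FreeGroup.induction_on with
    | C1 => simp
    | of x =>
      obtain ⟨a, i⟩ := x
      simp only [MulAut.mul_apply, FreeGroup.freeGroupCongr_apply, FreeGroup.map.of,
        Equiv.prodCongr_apply, Prod.map, Equiv.coe_addRight, Equiv.refl_apply, toAdd_mul]
      congr 2
      ring
    | inv_of x hx => rw [map_inv, hx, map_inv]
    | mul x y hx hy => rw [map_mul, hx, hy, map_mul]

theorem shAct_of (B : Type) (M : ℤ) (n : Multiplicative ℤ) (x : B) (i : ℤ) :
    shAct B M n (FreeGroup.of (x, i)) = FreeGroup.of (x, i + M * n.toAdd) := by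
  simp [shAct]

/-- The free group of rank three, as a semidirect product. -/
abbrev GZero : Type := FreeGroup (Bool × ℤ) ⋊[shAct Bool 1] Multiplicative ℤ

/-- The common shape of the associated subgroups. -/
abbrev EGrp (M : ℤ) : Type := FreeGroup (Unit × ℤ) ⋊[shAct Unit M] Multiplicative ℤ

theorem exists_emb (M : ℤ) (f : ℤ → ℤ) (k : ℤ) (hk : k ≠ 0) (hinj : Function.Injective f)
    (hf : ∀ i n, f (i + M * n) = f i + k * n) :
    ∃ α : EGrp M →* GZero, Function.Injective α ∧
      (∀ e, (α e).left = FreeGroup.map (fun p : Unit × ℤ => (true, f p.2)) e.left) ∧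
      (∀ e, (α e).right = e.right ^ k) := by
  let α : EGrp M →* GZero := SemidirectProduct.map
    (FreeGroup.map (fun p : Unit × ℤ => (true, f p.2))) (zpowGroupHom k) (by
      intro g
      ext p
      obtain ⟨⟨⟩, i⟩ := p
      simp only [MonoidHom.comp_apply, MulEquiv.coe_toMonoidHom, shAct_of, FreeGroup.map.of, hf,
        zpowGroupHom_apply, toAdd_zpow, smul_eq_mul, one_mul])
  refine ⟨α, ?_, fun _ => rfl, fun _ => rfl⟩
  intro x y hxy
  have h1 : (α x).left = (α y).left := by rw [hxy]
  have h2 : (α x).right = (α y).right := by rw [hxy]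
  apply SemidirectProduct.ext
  · refine FreeGroup.map_injective ?_ h1
    rintro ⟨⟨⟩, i⟩ ⟨⟨⟩, j⟩ hij
    simp only [Prod.mk.injEq, true_and] at hij
    rw [hinj hij]
  · have h3 : x.right ^ k = y.right ^ k := h2
    exact zpow_left_injective hk h3

/-- The copy of the subgroup spanned by the `b_i`, `i ∈ S`, in `GZero`. -/
def HZero (S : Set ℤ) : Subgroup GZero :=
  (Subgroup.closure (FreeGroup.of '' {p : Bool × ℤ | p.1 = true ∧ p.2 ∈ S})).map
    SemidirectProduct.inl

theorem mem_HZero (S : Set ℤ) (x : GZero) : x ∈ HZero S ↔ x.right = 1 ∧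
    x.left ∈ Subgroup.closure (FreeGroup.of '' {p : Bool × ℤ | p.1 = true ∧ p.2 ∈ S}) := by
  constructor
  · rintro ⟨y, hy, rfl⟩
    exact ⟨rfl, hy⟩
  · rintro ⟨h1, h2⟩
    refine ⟨x.left, h2, ?_⟩
    ext
    · rfl
    · simp [h1]

theorem emb_mem_iff (M : ℤ) (f : ℤ → ℤ) (k : ℤ) (hk : k ≠ 0) (hinj : Function.Injective f)
    (S : Set ℤ) (α : EGrp M →* GZero)
    (hl : ∀ e, (α e).left = FreeGroup.map (fun p : Unit × ℤ => (true, f p.2)) e.left)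
    (hr : ∀ e, (α e).right = e.right ^ k) (e : EGrp M) :
    α e ∈ HZero S ↔ e.right = 1 ∧
      e.left ∈ Subgroup.closure (FreeGroup.of '' {p : Unit × ℤ | f p.2 ∈ S}) := by
  rw [mem_HZero, hl, hr, map_mem_closure_iff]
  · have : e.right ^ k = 1 ↔ e.right = 1 := by
      constructor
      · intro h
        exact zpow_left_injective hk (by simpa using h)
      · intro h
        rw [h, one_zpow]
    rw [this]
    simp
  · rintro ⟨⟨⟩, i⟩ ⟨⟨⟩, j⟩ hij
    simp only [Prod.mk.injEq, true_and] at hij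
    rw [hinj hij]

/-- The embedding of the free group into `GZero`. -/
def thetaHom : FreeGroup (Fin 3) →* GZero :=
  FreeGroup.lift ![SemidirectProduct.inl (FreeGroup.of (false, 0)),
    SemidirectProduct.inl (FreeGroup.of (true, 0)),
    SemidirectProduct.inr (Multiplicative.ofAdd (-1))]

theorem exists_lambda : ∃ l : GZero →* FreeGroup (Fin 3), (∀ x, l (thetaHom x) = x) ∧
    ∀ i, l (SemidirectProduct.inl (FreeGroup.of (true, i))) = bseq3 i := by
  let fn : FreeGroup (Bool × ℤ) →* FreeGroup (Fin 3) :=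
    FreeGroup.lift fun p => cc3 ^ (-p.2) * (if p.1 then bb3 else FreeGroup.of 0) * cc3 ^ p.2
  let fg : Multiplicative ℤ →* FreeGroup (Fin 3) := zpowersHom _ cc3⁻¹
  let l : GZero →* FreeGroup (Fin 3) := SemidirectProduct.lift fn fg (by
    intro g
    ext p
    obtain ⟨x, i⟩ := p
    simp only [MonoidHom.comp_apply, MulEquiv.coe_toMonoidHom, shAct_of, fn, fg,
      FreeGroup.lift_apply_of, zpowersHom_apply, MulAut.conj_apply]
    simp only [one_mul, inv_zpow', zpow_add, neg_add_rev, mul_assoc, zpow_neg, inv_inv])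
  refine ⟨l, ?_, ?_⟩
  · intro x
    have : l.comp thetaHom = MonoidHom.id _ := by
      ext j
      fin_cases j <;> simp [l, thetaHom, fn, fg, bb3, cc3]
    exact DFunLike.congr_fun this x
  · intro i
    simp [l, fn, bseq3]

theorem thetaHom_bseq3 (i : ℤ) :
    thetaHom (bseq3 i) = SemidirectProduct.inl (FreeGroup.of (true, i)) := by
  have hc : ∀ j : ℤ, thetaHom cc3 ^ j = SemidirectProduct.inr (Multiplicative.ofAdd (-j)) := by
    intro j
    have : thetaHom cc3 = SemidirectProduct.inr (Multiplicative.ofAdd (-1)) := by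
      simp [thetaHom, cc3]
    rw [this, ← map_zpow, ← ofAdd_zsmul]
    simp
  have hb : thetaHom bb3 = SemidirectProduct.inl (FreeGroup.of (true, 0)) := by
    simp [thetaHom, bb3]
  rw [bseq3, map_mul, map_mul, map_zpow, map_zpow, hc, hc, hb, ofAdd_neg i, map_inv, neg_neg]
  rw [← map_inv, ← SemidirectProduct.inl_aut, shAct_of]
  simp

/-- Conjugates of `b` by powers of `c`. -/
def bgen {K : Type} [Group K] (b c : K) (i : ℤ) : K := c ^ (-i) * b * c ^ i

theorem bgen_add {K : Type} [Group K] (b c : K) (i j : ℤ) :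
    bgen b c (i + j) = c ^ (-j) * bgen b c i * c ^ j := by
  simp only [bgen, zpow_add, neg_add_rev, mul_assoc]

theorem conj_bgen {K : Type} [Group K] (b c t : K) (k l i j : ℤ)
    (hc : t * c ^ k * t⁻¹ = c ^ l) (hb : t * bgen b c i * t⁻¹ = bgen b c j) (n : ℤ) :
    t * bgen b c (i + k * n) * t⁻¹ = bgen b c (j + l * n) := by
  have h : ∀ n : ℤ, t * c ^ (k * n) * t⁻¹ = c ^ (l * n) := by
    intro n
    rw [zpow_mul, zpow_mul, ← hc, conj_zpow]
  have h1 := h n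
  have h2 := h (-n)
  rw [bgen_add, bgen_add, ← hb, ← mul_neg, ← mul_neg, ← h1, ← h2]
  group

theorem gen_mem {K : Type} [Group K] (b c t s : K) (m : ℕ) (M : ℤ) (hM : M = m + 1)
    (h1 : t * c ^ M * t⁻¹ = c ^ (2 * M)) (h2 : s * c ^ (2 * M) * s⁻¹ = c ^ (2 * M))
    (h3 : ∀ r : ℤ, 0 ≤ r → r < M → t * bgen b c r * t⁻¹ = bgen b c r)
    (h4 : ∀ r : ℤ, 0 ≤ r → r < M → s * bgen b c (r + M) * s⁻¹ = bgen b c (r + 3 * M))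
    (L : Subgroup K) (ht : t ∈ L) (hs : s ∈ L)
    (hL : ∀ i : ℤ, m ≤ i → i < 2 * M → bgen b c i ∈ L) (i : ℤ) (hi : i < 0 ∨ (m : ℤ) ≤ i) :
    bgen b c i ∈ L := by
  have hconj : ∀ u ∈ L, ∀ x : K, u * x * u⁻¹ ∈ L ↔ x ∈ L := by
    intro u hu x
    rw [mul_mem_cancel_right (inv_mem hu), mul_mem_cancel_left hu]
  have hodd : ∀ r : ℤ, 0 ≤ r → r < M → ∀ q : ℤ, bgen b c (r + M + 2 * M * q) ∈ L := by
    intro r hr0 hr q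
    have key : ∀ q : ℤ, bgen b c (r + M + 2 * M * q) ∈ L ↔
        bgen b c (r + M + 2 * M * (q + 1)) ∈ L := by
      intro q
      have := conj_bgen b c s (2 * M) (2 * M) (r + M) (r + 3 * M) h2 (h4 r hr0 hr) q
      rw [← hconj s hs (bgen b c (r + M + 2 * M * q)), this]
      ring_nf
    induction q with
    | zero => exact hL _ (by omega) (by omega)
    | succ n ih => exact (key _).1 ih
    | pred n ih =>
      rw [key]
      simpa using ih
  have hall : ∀ n : ℕ, ∀ q : ℤ, q.natAbs = n → ∀ r : ℤ, 0 ≤ r → r < M →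
      (q = 0 → (m : ℤ) ≤ r) → bgen b c (r + M * q) ∈ L := by
    intro n
    induction n using Nat.strong_induction_on with
    | _ n ih =>
      intro q hq r hr0 hr hq0
      rcases Int.even_or_odd' q with ⟨p, hp | hp⟩
      · by_cases h0 : q = 0
        · have := hL r (hq0 h0) (by omega)
          simpa [h0] using this
        · have := ih p.natAbs (by omega) p rfl r hr0 hr (by omega)
          rw [← hconj t ht, conj_bgen b c t M (2 * M) r r h1 (h3 r hr0 hr)] at this
          rw [hp]
          convert this using 2
          ring
      · have := hodd r hr0 hr p
        rw [hp]
        convert this using 2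
        ring
  have hMpos : 0 < M := by omega
  have hd := Int.emod_add_mul_ediv i M
  have := hall _ (i / M) rfl (i % M) (Int.emod_nonneg _ hMpos.ne') (Int.emod_lt_of_pos _ hMpos) (by
    intro h0
    rw [h0] at hd
    have := Int.emod_nonneg i hMpos.ne'
    omega)
  rwa [hd] at this

/-- The relators of the finitely presented overgroup. -/
noncomputable def relSet (M : ℕ) : Finset (FreeGroup (Fin 5)) := by
  classical
  exact
  let b : FreeGroup (Fin 5) := FreeGroup.of 1
  let c : FreeGroup (Fin 5) := FreeGroup.of 2
  let t : FreeGroup (Fin 5) := FreeGroup.of 3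
  let s : FreeGroup (Fin 5) := FreeGroup.of 4
  {t * c ^ (M : ℤ) * t⁻¹ * (c ^ (2 * M : ℤ))⁻¹, s * c ^ (2 * M : ℤ) * s⁻¹ * (c ^ (2 * M : ℤ))⁻¹} ∪
  (Finset.range M).image (fun r : ℕ => t * bgen b c r * t⁻¹ * (bgen b c r)⁻¹) ∪
  (Finset.range M).image (fun r : ℕ => s * bgen b c (r + M) * s⁻¹ * (bgen b c (r + 3 * M))⁻¹)

theorem mem_relSet (M : ℕ) (x : FreeGroup (Fin 5)) : x ∈ relSet M ↔
    x = FreeGroup.of 3 * FreeGroup.of 2 ^ (M : ℤ) * (FreeGroup.of 3)⁻¹ *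
      (FreeGroup.of 2 ^ (2 * M : ℤ))⁻¹ ∨
    x = FreeGroup.of 4 * FreeGroup.of 2 ^ (2 * M : ℤ) * (FreeGroup.of 4)⁻¹ *
      (FreeGroup.of 2 ^ (2 * M : ℤ))⁻¹ ∨
    (∃ r : ℕ, r < M ∧ x = FreeGroup.of 3 * bgen (FreeGroup.of 1) (FreeGroup.of 2) r *
      (FreeGroup.of 3)⁻¹ * (bgen (FreeGroup.of 1) (FreeGroup.of 2) r)⁻¹) ∨
    (∃ r : ℕ, r < M ∧ x = FreeGroup.of 4 * bgen (FreeGroup.of 1) (FreeGroup.of 2) (r + M) *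
      (FreeGroup.of 4)⁻¹ * (bgen (FreeGroup.of 1) (FreeGroup.of 2) (r + 3 * M))⁻¹) := by
  classical
  simp only [relSet, Finset.mem_union, Finset.mem_image, Finset.mem_insert, Finset.mem_singleton,
    Finset.mem_range, or_assoc, eq_comm]

theorem map_bgen {K K' : Type} [Group K] [Group K'] (f : K →* K') (b c : K) (i : ℤ) :
    f (bgen b c i) = bgen (f b) (f c) i := by
  simp [bgen]

/-- The concrete overgroup where both stable letters live. -/
theorem exists_tower (m : ℕ) (M : ℕ) (hM : M = m + 1) :
    ∃ (G : Type) (_ : Group G) (j : GZero →* G) (t s : G) (H : Subgroup G),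
      Function.Injective j ∧ t ∈ H ∧ s ∈ H ∧
      (∀ g, j g ∈ H ↔ g ∈ HZero {i : ℤ | i < 0 ∨ (m : ℤ) ≤ i}) ∧
      (t * j (thetaHom cc3) ^ (M : ℤ) * t⁻¹ = j (thetaHom cc3) ^ (2 * M : ℤ)) ∧
      (s * j (thetaHom cc3) ^ (2 * M : ℤ) * s⁻¹ = j (thetaHom cc3) ^ (2 * M : ℤ)) ∧
      (∀ r : ℕ, r < M → t * j (thetaHom (bseq3 r)) * t⁻¹ = j (thetaHom (bseq3 r))) ∧
      (∀ r : ℕ, r < M → s * j (thetaHom (bseq3 (r + M))) * s⁻¹ =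
        j (thetaHom (bseq3 (r + 3 * M)))) := by
  set S : Set ℤ := {i : ℤ | i < 0 ∨ (m : ℤ) ≤ i} with hS
  have hM0 : (0 : ℤ) < M := by omega
  let f : ℤ → ℤ := fun i => i + M * (i / M)
  have hfd : ∀ i, f i = i % M + 2 * M * (i / M) := by
    intro i
    have := Int.emod_add_mul_ediv i M
    simp only [f]
    linarith
  have hf : ∀ i n, f (i + M * n) = f i + (2 * M) * n := by
    intro i n
    simp only [f]
    rw [Int.add_mul_ediv_left _ _ hM0.ne']
    ring
  have hfinj : Function.Injective f := by
    intro x y hxy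
    rw [hfd, hfd] at hxy
    have hx0 := Int.emod_nonneg x hM0.ne'
    have hx1 := Int.emod_lt_of_pos x hM0
    have hy0 := Int.emod_nonneg y hM0.ne'
    have hy1 := Int.emod_lt_of_pos y hM0
    have hx := Int.emod_add_mul_ediv x M
    have hy := Int.emod_add_mul_ediv y M
    have hq : x / M = y / M := by
      rcases lt_trichotomy (x / (M : ℤ)) (y / M) with h | h | h
      · nlinarith
      · exact h
      · nlinarith
    rw [hq] at hxy hx
    omega
  have hfS : ∀ i, f i ∈ S ↔ i ∈ S := by
    intro i
    have hx0 := Int.emod_nonneg i hM0.ne'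
    have hx1 := Int.emod_lt_of_pos i hM0
    have hx := Int.emod_add_mul_ediv i M
    simp only [hS, Set.mem_ofPred_eq, hfd]
    rcases lt_trichotomy (i / (M : ℤ)) 0 with h | h | h
    · have h1 : i % M + 2 * M * (i / M) < 0 := by nlinarith
      have h2 : i < 0 := by nlinarith
      exact ⟨fun _ => Or.inl h2, fun _ => Or.inl h1⟩
    · rw [h] at hx ⊢
      simp only [mul_zero, add_zero] at hx ⊢
      rw [hx]
    · have h1 : (m : ℤ) ≤ i % M + 2 * M * (i / M) := by
        have : (m : ℤ) + 1 = M := by omega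
        nlinarith
      have h2 : (m : ℤ) ≤ i := by
        have : (m : ℤ) + 1 = M := by omega
        nlinarith
      exact ⟨fun _ => Or.inr h2, fun _ => Or.inr h1⟩
  have hfodd : ∀ i (a : ℤ), Odd a → f i + a * M ∈ S := by
    rintro i a ⟨k, rfl⟩
    have hx0 := Int.emod_nonneg i hM0.ne'
    have hx1 := Int.emod_lt_of_pos i hM0
    simp only [hS, Set.mem_ofPred_eq, hfd]
    have hmM : (m : ℤ) + 1 = M := by omega
    rcases le_or_gt 0 (i / (M : ℤ) + k) with h | h
    · right
      have := mul_nonneg hM0.le h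
      nlinarith
    · left
      have : (M : ℤ) * (i / (M : ℤ) + k) ≤ M * (-1) := mul_le_mul_of_nonneg_left (by omega) hM0.le
      nlinarith
  have h2M : (2 * M : ℤ) ≠ 0 := by omega
  obtain ⟨α₁, hα₁, hα₁l, hα₁r⟩ := exists_emb M (fun i => i) M hM0.ne' (fun _ _ h => h)
    (fun _ _ => rfl)
  obtain ⟨β₁, hβ₁, hβ₁l, hβ₁r⟩ := exists_emb M f (2 * M) h2M hfinj hf
  have hginj : ∀ a : ℤ, Function.Injective fun i => f i + a * M := fun a x y h =>
    hfinj (add_right_cancel h)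
  have hgf : ∀ a : ℤ, ∀ i n, f (i + M * n) + a * M = f i + a * M + (2 * M) * n := by
    intro a i n
    rw [hf]; ring
  obtain ⟨α₂, hα₂, hα₂l, hα₂r⟩ := exists_emb M _ (2 * M) h2M (hginj 1) (hgf 1)
  obtain ⟨β₂, hβ₂, hβ₂l, hβ₂r⟩ := exists_emb M _ (2 * M) h2M (hginj 3) (hgf 3)
  have hiff₁ : ∀ e, α₁ e ∈ HZero S ↔ β₁ e ∈ HZero S := by
    intro e
    rw [emb_mem_iff M _ _ hM0.ne' (fun _ _ h => h) S α₁ hα₁l hα₁r,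
      emb_mem_iff M _ _ h2M hfinj S β₁ hβ₁l hβ₁r]
    simp only [hfS]
  have hiff₂ : ∀ e, α₂ e ∈ HZero S ↔ β₂ e ∈ HZero S := by
    intro e
    rw [emb_mem_iff M _ _ h2M (hginj 1) S α₂ hα₂l hα₂r,
      emb_mem_iff M _ _ h2M (hginj 3) S β₂ hβ₂l hβ₂r]
    simp only [hfodd _ 1 (by decide), hfodd _ 3 (by decide)]
  obtain ⟨G₁, _, ι₁, t, hι₁, ht, hH₁⟩ := hnn_exists α₁ β₁ hα₁ hβ₁ (HZero S) hiff₁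
  have hH₁' : ∀ g, ι₁ g ∈ (HZero S).map ι₁ ⊔ Subgroup.zpowers t ↔ g ∈ HZero S := fun g =>
    ⟨hH₁ g, fun h => Subgroup.mem_sup_left ⟨g, h, rfl⟩⟩
  obtain ⟨G₂, _, ι₂, s, hι₂, hs, hH₂⟩ := hnn_exists (ι₁.comp α₂) (ι₁.comp β₂) (hι₁.comp hα₂)
    (hι₁.comp hβ₂) ((HZero S).map ι₁ ⊔ Subgroup.zpowers t) (fun e => by
      simp only [MonoidHom.comp_apply, hH₁', hiff₂])
  have hcc : ∀ n : ℤ, thetaHom cc3 ^ n = SemidirectProduct.inr (Multiplicative.ofAdd (-n)) := by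
    intro j
    have : thetaHom cc3 = SemidirectProduct.inr (Multiplicative.ofAdd (-1)) := by
      simp [thetaHom, cc3]
    rw [this, ← map_zpow, ← ofAdd_zsmul]
    simp
  have hembr : ∀ (α : EGrp M →* GZero) (k : ℤ) (f : ℤ → ℤ)
      (_ : ∀ e, (α e).left = FreeGroup.map (fun p : Unit × ℤ => (true, f p.2)) e.left)
      (_ : ∀ e, (α e).right = e.right ^ k),
      α (SemidirectProduct.inr (Multiplicative.ofAdd (-1))) = thetaHom cc3 ^ k := by
    intro α k f h1 h2
    rw [hcc]
    apply SemidirectProduct.ext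
    · rw [h1]; simp
    · rw [h2]
      simp only [SemidirectProduct.right_inr]
      rw [← ofAdd_zsmul]; simp
  have hembl : ∀ (α : EGrp M →* GZero) (k : ℤ) (f : ℤ → ℤ)
      (_ : ∀ e, (α e).left = FreeGroup.map (fun p : Unit × ℤ => (true, f p.2)) e.left)
      (_ : ∀ e, (α e).right = e.right ^ k) (i : ℤ),
      α (SemidirectProduct.inl (FreeGroup.of ((), i))) = thetaHom (bseq3 (f i)) := by
    intro α k f h1 h2 i
    rw [thetaHom_bseq3]
    apply SemidirectProduct.ext
    · rw [h1]; simp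
    · rw [h2]; simp
  have hfr : ∀ r : ℕ, r < M → f r = r := by
    intro r hr
    have : (r : ℤ) / M = 0 := Int.ediv_eq_zero_of_lt (by omega) (by omega)
    simp [f, this]
  refine ⟨G₂, inferInstance, ι₂.comp ι₁, ι₂ t, s,
    ((HZero S).map ι₁ ⊔ Subgroup.zpowers t).map ι₂ ⊔ Subgroup.zpowers s, hι₂.comp hι₁,
    Subgroup.mem_sup_left ⟨t, Subgroup.mem_sup_right (Subgroup.mem_zpowers t), rfl⟩,
    Subgroup.mem_sup_right (Subgroup.mem_zpowers s), ?_, ?_, ?_, ?_, ?_⟩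
  · intro g
    refine ⟨fun h => (hH₁' g).1 (hH₂ _ h), fun h => ?_⟩
    exact Subgroup.mem_sup_left ⟨_, (hH₁' g).2 h, rfl⟩
  · have := ht (SemidirectProduct.inr (Multiplicative.ofAdd (-1)))
    rw [hembr α₁ _ (fun i => i) hα₁l hα₁r, hembr β₁ _ f hβ₁l hβ₁r] at this
    simpa only [map_mul, map_inv, map_zpow, MonoidHom.comp_apply] using congrArg ι₂ this
  · have := hs (SemidirectProduct.inr (Multiplicative.ofAdd (-1)))
    simp only [MonoidHom.comp_apply] at this
    rw [hembr α₂ _ (fun i => f i + 1 * M) hα₂l hα₂r, hembr β₂ _ (fun i => f i + 3 * M) hβ₂l hβ₂r] at this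
    simpa only [map_zpow, MonoidHom.comp_apply] using this
  · intro r hr
    have := ht (SemidirectProduct.inl (FreeGroup.of ((), r)))
    rw [hembl α₁ _ (fun i => i) hα₁l hα₁r, hembl β₁ _ f hβ₁l hβ₁r, hfr r hr] at this
    simpa only [map_mul, map_inv, MonoidHom.comp_apply] using congrArg ι₂ this
  · intro r hr
    have := hs (SemidirectProduct.inl (FreeGroup.of ((), r)))
    simp only [MonoidHom.comp_apply] at this
    rw [hembl α₂ _ (fun i => f i + 1 * M) hα₂l hα₂r, hembl β₂ _ (fun i => f i + 3 * M) hβ₂l hβ₂r, hfr r hr] at this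
    simpa only [MonoidHom.comp_apply, one_mul] using this

theorem benign_three (m : ℕ) :
    Benign (Subgroup.closure {x | ∃ i : ℤ, (i < 0 ∨ (m : ℤ) ≤ i) ∧ x = bseq3 i}) := by
  obtain ⟨G, _, j, t, s, H, hj, htH, hsH, hjH, h1, h2, h3, h4⟩ := exists_tower m (m + 1) rfl
  generalize hMM : m + 1 = M at *
  obtain ⟨l, hl1, hl2⟩ := exists_lambda
  let R := Subgroup.normalClosure (relSet M : Set (FreeGroup (Fin 5)))
  let π : FreeGroup (Fin 5) →* FreeGroup (Fin 5) ⧸ R := QuotientGroup.mk' R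
  have hπ : ∀ x y, x * y⁻¹ ∈ relSet M → π x = π y := by
    intro x y h
    have h5 : π (x * y⁻¹) = 1 :=
      (QuotientGroup.eq_one_iff _).2 (Subgroup.subset_normalClosure h)
    rwa [map_mul, map_inv, mul_inv_eq_one] at h5
  let Ψ₀ : FreeGroup (Fin 5) →* G := FreeGroup.lift
    ![j (thetaHom (FreeGroup.of 0)), j (thetaHom bb3), j (thetaHom cc3), t, s]
  have e1 : Ψ₀ (FreeGroup.of 1) = j (thetaHom bb3) := by simp [Ψ₀]
  have e2 : Ψ₀ (FreeGroup.of 2) = j (thetaHom cc3) := by simp [Ψ₀]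
  have e3 : Ψ₀ (FreeGroup.of 3) = t := by simp [Ψ₀]
  have e4 : Ψ₀ (FreeGroup.of 4) = s := by simp [Ψ₀]
  have eb : ∀ i, bgen (j (thetaHom bb3)) (j (thetaHom cc3)) i = j (thetaHom (bseq3 i)) := by
    intro i
    simp [bgen, bseq3]
  have hR : R ≤ Ψ₀.ker := by
    refine Subgroup.normalClosure_le_normal ?_
    intro x hx
    rw [Finset.mem_coe, mem_relSet] at hx
    change Ψ₀ x = 1
    rcases hx with rfl | rfl | ⟨r, hr, rfl⟩ | ⟨r, hr, rfl⟩
    · rw [map_mul, map_inv, mul_inv_eq_one]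
      simpa only [map_mul, map_inv, map_zpow, e2, e3] using h1
    · rw [map_mul, map_inv, mul_inv_eq_one]
      simpa only [map_mul, map_inv, map_zpow, e2, e4] using h2
    · rw [map_mul, map_inv, mul_inv_eq_one]
      simpa only [map_mul, map_inv, map_bgen, e1, e2, e3, eb] using h3 r hr
    · rw [map_mul, map_inv, mul_inv_eq_one]
      simpa only [map_mul, map_inv, map_bgen, e1, e2, e4, eb] using h4 r hr
  let Ψ : FreeGroup (Fin 5) ⧸ R →* G := QuotientGroup.lift R Ψ₀ hR
  have hΨ : ∀ x, Ψ (π x) = Ψ₀ x := fun x => rfl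
  let ι : FreeGroup (Fin 3) →* FreeGroup (Fin 5) ⧸ R :=
    π.comp (FreeGroup.lift ![FreeGroup.of 0, FreeGroup.of 1, FreeGroup.of 2])
  have hΨι : ∀ x, Ψ (ι x) = j (thetaHom x) := by
    intro x
    have : Ψ.comp ι = j.comp thetaHom := by
      ext k
      fin_cases k <;> simp [ι, hΨ, Ψ₀, bb3, cc3]
    exact DFunLike.congr_fun this x
  have hιinj : Function.Injective ι := by
    intro x y hxy
    have h5 := hΨι x
    rw [hxy, hΨι] at h5
    rw [← hl1 x, ← hl1 y, hj h5]
  have ιb : ι bb3 = π (FreeGroup.of 1) := by simp [ι, bb3]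
  have ιc : ι cc3 = π (FreeGroup.of 2) := by simp [ι, cc3]
  have ιbs : ∀ i, ι (bseq3 i) = bgen (π (FreeGroup.of 1)) (π (FreeGroup.of 2)) i := by
    intro i
    rw [← ιb, ← ιc, ← map_bgen]
    rfl
  let gens : Set (FreeGroup (Fin 5) ⧸ R) :=
    {π (FreeGroup.of 3), π (FreeGroup.of 4)} ∪
      (fun i => ι (bseq3 i)) '' (Set.Ico (m : ℤ) (2 * M))
  refine ⟨FreeGroup (Fin 5) ⧸ R, inferInstance, ι, Subgroup.closure gens, hιinj,
    ⟨5, relSet M, ⟨MulEquiv.refl _⟩⟩, ?_, ?_⟩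
  · rw [Subgroup.fg_iff]
    exact ⟨gens, rfl, (Set.toFinite _).union ((Set.finite_Ico _ _).image _)⟩
  · apply le_antisymm
    · rintro _ ⟨⟨y, rfl⟩, hy⟩
      have hle : Subgroup.closure gens ≤ H.comap Ψ := by
        rw [Subgroup.closure_le]
        rintro x ((rfl | rfl) | ⟨i, hi, rfl⟩)
        · change Ψ (π _) ∈ H
          rw [hΨ, e3]; exact htH
        · change Ψ (π _) ∈ H
          rw [hΨ, e4]; exact hsH
        · change Ψ (ι (bseq3 i)) ∈ H
          rw [hΨι, hjH, thetaHom_bseq3]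
          exact ⟨_, Subgroup.subset_closure ⟨_, ⟨rfl, Or.inr hi.1⟩, rfl⟩, rfl⟩
      have h6 : Ψ (ι y) ∈ H := hle hy
      rw [hΨι, hjH] at h6
      refine ⟨y, ?_, rfl⟩
      have hle2 : HZero {i : ℤ | i < 0 ∨ (m : ℤ) ≤ i} ≤
          (Subgroup.closure {x | ∃ i : ℤ, (i < 0 ∨ (m : ℤ) ≤ i) ∧ x = bseq3 i}).comap l := by
        rw [HZero, MonoidHom.map_closure, Subgroup.closure_le]
        rintro _ ⟨_, ⟨⟨p, i⟩, ⟨hp, hi⟩, rfl⟩, rfl⟩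
        obtain rfl : p = true := hp
        rw [SetLike.mem_coe, Subgroup.mem_comap, hl2]
        exact Subgroup.subset_closure ⟨i, hi, rfl⟩
      have h7 := hle2 h6
      rw [Subgroup.mem_comap, hl1] at h7
      exact h7
    · rw [Subgroup.map_le_iff_le_comap, Subgroup.closure_le]
      rintro _ ⟨i, hi, rfl⟩
      refine ⟨⟨_, rfl⟩, ?_⟩
      rw [ιbs]
      refine gen_mem (π (FreeGroup.of 1)) (π (FreeGroup.of 2)) (π (FreeGroup.of 3))
        (π (FreeGroup.of 4)) m M (by omega) ?_ ?_ ?_ ?_ (Subgroup.closure gens)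
        (Subgroup.subset_closure (Or.inl (Or.inl rfl)))
        (Subgroup.subset_closure (Or.inl (Or.inr rfl))) ?_ i hi
      · have := hπ _ _ ((mem_relSet M _).2 (Or.inl rfl))
        simpa only [map_mul, map_inv, map_zpow] using this
      · have := hπ _ _ ((mem_relSet M _).2 (Or.inr (Or.inl rfl)))
        simpa only [map_mul, map_inv, map_zpow] using this
      · intro r hr0 hr
        lift r to ℕ using hr0
        have := hπ _ _ ((mem_relSet M _).2 (Or.inr (Or.inr (Or.inl ⟨r, by omega, rfl⟩))))
        simpa only [map_mul, map_inv, map_bgen] using this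
      · intro r hr0 hr
        lift r to ℕ using hr0
        have := hπ _ _ ((mem_relSet M _).2 (Or.inr (Or.inr (Or.inr ⟨r, by omega, rfl⟩))))
        simpa only [map_mul, map_inv, map_bgen] using this
      · intro i hi1 hi2
        rw [← ιbs]
        exact Subgroup.subset_closure (Or.inr ⟨i, ⟨hi1, hi2⟩, rfl⟩)

theorem benign_comap {G G' : Type} [Group G] [Group G'] (f : G →* G') (hf : Function.Injective f)
    (H : Subgroup G) (h : Benign (H.map f)) : Benign H := by
  obtain ⟨K, _, ι, L, hι, hK, hL, he⟩ := h
  refine ⟨K, inferInstance, ι.comp f, L, hι.comp hf, hK, hL, ?_⟩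
  rw [← Subgroup.map_map, ← he]
  apply le_antisymm
  · rintro _ ⟨⟨x, rfl⟩, hx⟩
    exact ⟨⟨f x, rfl⟩, hx⟩
  · intro x hx
    refine ⟨?_, hx.2⟩
    rw [he] at hx
    obtain ⟨_, ⟨y, hy, rfl⟩, rfl⟩ := hx
    exact ⟨y, rfl⟩

theorem benign_two (m : ℕ) :
    Benign (Subgroup.closure {x | ∃ i : ℤ, (i < 0 ∨ (m : ℤ) ≤ i) ∧ x = bseq i}) := by
  have hb : ∀ i, FreeGroup.map Fin.succ (bseq i) = bseq3 i := by
    intro i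
    simp only [bseq, bseq3, map_mul, map_zpow, bb, cc, bb3, cc3, FreeGroup.map.of]
    rfl
  refine benign_comap (FreeGroup.map (Fin.succ : Fin 2 → Fin 3))
    (FreeGroup.map_injective (Fin.succ_injective 2)) _ ?_
  convert benign_three m using 1
  rw [MonoidHom.map_closure]
  congr 1
  ext x
  constructor
  · rintro ⟨_, ⟨i, hi, rfl⟩, rfl⟩
    exact ⟨i, hi, hb i⟩
  · rintro ⟨i, hi, rfl⟩
    exact ⟨_, ⟨i, hi, rfl⟩, hb i⟩

theorem stmt19 (m : ℕ) :
    -- the subgroup `⟨…, b_{-2}, b_{-1}, b_m, b_{m+1}, …⟩` is benign in `F = ⟨b, c⟩` …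
    Benign (Subgroup.closure {x | ∃ i : ℤ, (i < 0 ∨ (m : ℤ) ≤ i) ∧ x = bseq i}) ∧
    -- … and is benign in the free group `⟨a, b, c⟩` of rank 3 containing `F` as the
    -- free factor generated by `b` and `c`:
    Benign (Subgroup.closure {x | ∃ i : ℤ, (i < 0 ∨ (m : ℤ) ≤ i) ∧ x = bseq3 i}) := by
  exact ⟨benign_two m, benign_three m⟩
end
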